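/- arXiv:1402.4928 — 2 statements merged into one kernel-verified Lean document; each statement's English description precedes it below -/
import Mathlib

section
/- In the field of formal Laurent series F_q((1/T)) over a finite field F_q, a power series α = Σ_{n≤k} a_n T^n belongs to the rational function field F_q(T) if and only if its coefficient sequence (a_n)_{n≤k} is eventually periodic. -/
open Polynomial

/-- `T = 1/X` in the Laurent series field `F((X)) = F_q((1/T))`. -/
noncomputable def Tvar (F : Type*) [Field F] : LaurentSeries F := HahnSeries.single (-1) 1

theorem Tvar_pow (F : Type*) [Field F] (k : ℕ) :
    Tvar F ^ k = HahnSeries.single (-(k : ℤ)) 1 := by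
  simp [Tvar, HahnSeries.single_pow]

theorem coeff_mul_Tvar_pow {F : Type*} [Field F] (α : LaurentSeries F) (k : ℕ) (n : ℤ) :
    (α * Tvar F ^ k).coeff n = α.coeff (n + k) := by
  rw [Tvar_pow, HahnSeries.coeff_mul_single, mul_one, sub_neg_eq_add]

theorem coeff_aeval_Tvar {F : Type*} [Field F] (P : F[X]) (n : ℤ) :
    (aeval (Tvar F) P).coeff n = if n ≤ 0 then P.coeff (-n).toNat else 0 := by
  induction P using Polynomial.induction_on' with
  | add p q hp hq =>
    rw [map_add, HahnSeries.coeff_add, hp, hq]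
    split_ifs <;> simp
  | monomial k a =>
    rw [aeval_monomial, Tvar_pow, LaurentSeries.algebraMap_apply, HahnSeries.C_mul_eq_smul,
      HahnSeries.coeff_smul, HahnSeries.coeff_single, coeff_monomial]
    split_ifs <;> first | omega | simp

/-- A Laurent series in `1/T` is a polynomial in `T` exactly when its fractional part vanishes. -/
theorem exists_eq_aeval_Tvar_iff {F : Type*} [Field F] (β : LaurentSeries F) :
    (∃ P : F[X], β = aeval (Tvar F) P) ↔ ∀ n : ℤ, 0 < n → β.coeff n = 0 := by
  constructor
  · rintro ⟨P, rfl⟩ n hn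
    rw [coeff_aeval_Tvar, if_neg (not_le.mpr hn)]
  · intro h
    refine ⟨∑ i ∈ Finset.range ((-β.order).toNat + 1), monomial i (β.coeff (-(i : ℤ))), ?_⟩
    ext n
    rw [coeff_aeval_Tvar]
    split_ifs with hn
    · simp only [finsetSum_coeff, coeff_monomial, Finset.sum_ite_eq', Finset.mem_range]
      split_ifs with hlt
      · congr 1
        omega
      · exact HahnSeries.coeff_eq_zero_of_lt_order (by omega)
    · exact h n (not_le.mp hn)

/-- Over a finite field, every nonzero polynomial divides some `X ^ j - X ^ i` with `i < j`. -/
theorem exists_dvd_X_pow_sub_X_pow {F : Type*} [Field F] [Finite F] {Q : F[X]} (hQ : Q ≠ 0) :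
    ∃ i j : ℕ, i < j ∧ Q ∣ X ^ j - X ^ i := by
  have : Module.Finite F (AdjoinRoot Q) := (AdjoinRoot.powerBasis hQ).finite
  have : Finite (AdjoinRoot Q) := Module.finite_of_finite F
  obtain ⟨i, j, hne, h⟩ := Finite.exists_ne_map_eq_of_infinite fun k : ℕ ↦ AdjoinRoot.mk Q (X ^ k)
  rcases hne.lt_or_gt with hlt | hlt
  · exact ⟨i, j, hlt, AdjoinRoot.mk_eq_mk.mp h.symm⟩
  · exact ⟨j, i, hlt, AdjoinRoot.mk_eq_mk.mp h⟩

/-- Over a finite field, a formal Laurent series in `1/T` is a rational function of `T`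
if and only if its coefficient sequence is eventually periodic. -/
theorem rational_iff_eventually_periodic (F : Type*) [Field F] [Fintype F]
    (α : LaurentSeries F) :
    (∃ P Q : Polynomial F, Q ≠ 0 ∧ α * aeval (Tvar F) Q = aeval (Tvar F) P) ↔
      (∃ N : ℤ, ∃ t : ℕ, 0 < t ∧ ∀ n : ℤ, N ≤ n → α.coeff (n + t) = α.coeff n) := by
  have key (i j : ℕ) (n : ℤ) : (α * aeval (Tvar F) (X ^ j - X ^ i : F[X])).coeff n =
      α.coeff (n + j) - α.coeff (n + i) := by
    simp [mul_sub, coeff_mul_Tvar_pow]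
  constructor
  · rintro ⟨P, Q, hQ, h⟩
    obtain ⟨i, j, hij, R, hR⟩ := exists_dvd_X_pow_sub_X_pow hQ
    refine ⟨i + 1, j - i, by omega, fun n hn ↦ ?_⟩
    have hz := (exists_eq_aeval_Tvar_iff (α * aeval (Tvar F) (X ^ j - X ^ i : F[X]))).mp
      ⟨P * R, by rw [hR, map_mul, map_mul, ← mul_assoc, h]⟩ (n - i) (by omega)
    rw [key, sub_eq_zero] at hz
    convert hz using 2 <;> omega
  · rintro ⟨N, t, ht, h⟩
    obtain ⟨P, hP⟩ := (exists_eq_aeval_Tvar_iff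
      (α * aeval (Tvar F) (X ^ (N.toNat + t) - X ^ N.toNat : F[X]))).mpr fun n hn ↦ by
        rw [key, sub_eq_zero, ← h (n + N.toNat) (by omega)]
        push_cast
        rw [add_assoc]
    refine ⟨P, _, fun h0 ↦ ?_, hP⟩
    have := congrArg natDegree (sub_eq_zero.mp h0)
    simp only [natDegree_X_pow] at this
    omega
end

section
/- Let p > 3 be a prime. The polynomial P(X) = (9/32)X^4 - TX^3 + X^2 - 8/27 ∈ F_p(T)[X] has a unique root α in F_p((1/T)), and this root satisfies α = (32/9)T - T^{-1} + (terms of absolute value less than |T|^{-1}). -/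
open PowerSeries in
/-- Hensel lifting of the simple root `c` of `Y⁴ - c Y³`, together with its expansion. -/
theorem exists_powerSeries_root {F : Type*} [Field F] {c : F} (hc : c ≠ 0) (d : F) :
    ∃ u z : F⟦X⟧, u ^ 4 - C c * u ^ 3 + C c * X ^ 2 * u ^ 2 - C d * X ^ 4 = 0 ∧
      u = C c - X ^ 2 + X ^ 3 * z := by
  let f : Polynomial F⟦X⟧ :=
    .X ^ 4 - .C (C c) * .X ^ 3 + .C (C c * X ^ 2) * .X ^ 2 - .C (C d * X ^ 4)
  have hf : f.Monic := by
    simp only [f]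
    monicity!
  have heval (u : F⟦X⟧) :
      f.eval u = u ^ 4 - C c * u ^ 3 + C c * X ^ 2 * u ^ 2 - C d * X ^ 4 := by simp [f]
  obtain ⟨u, hu, hX⟩ := HenselianRing.is_henselian (I := Ideal.span {(X : F⟦X⟧)}) f hf (C c)
    (by
      rw [heval, Ideal.mem_span_singleton, X_dvd_iff]
      simp
      ring)
    (by
      refine IsUnit.map _ (isUnit_iff_constantCoeff.2 (isUnit_iff_ne_zero.2 ?_))
      have h : constantCoeff (f.derivative.eval (C c)) = c ^ 3 := by
        have hder : f.derivative.eval (C c) =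
            4 * C c ^ 3 - C c * (3 * C c ^ 2) + C c * X ^ 2 * (2 * C c) := by
          simp only [f, Polynomial.derivative_sub, Polynomial.derivative_add,
            Polynomial.derivative_C_mul, Polynomial.derivative_C, Polynomial.derivative_X_pow]
          simp
        simp only [hder, map_sub, map_add, map_mul, map_pow, constantCoeff_C, constantCoeff_X,
          map_ofNat]
        ring
      rw [h]
      exact pow_ne_zero 3 hc)
  rw [Polynomial.IsRoot, heval] at hu
  rw [Ideal.mem_span_singleton, X_dvd_iff, map_sub, constantCoeff_C, sub_eq_zero] at hX
  have hunit : IsUnit u := isUnit_iff_constantCoeff.2 (isUnit_iff_ne_zero.2 (hX ▸ hc))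
  have hX2 : (X : F⟦X⟧) ^ 2 ∣ u - C c := by
    rw [← (hunit.pow 3).dvd_mul_right]
    exact ⟨C d * X ^ 2 - C c * u ^ 2, by linear_combination hu⟩
  obtain ⟨w, hw⟩ := hX2
  have hwu : w * u ^ 3 + C c * u ^ 2 - C d * X ^ 2 = 0 := by
    refine mul_left_cancel₀ (pow_ne_zero 2 (X_ne_zero (R := F))) ?_
    linear_combination hu - u ^ 3 * hw
  have hw0 : constantCoeff w + 1 = 0 := by
    have h := congrArg constantCoeff hwu
    simp only [map_sub, map_add, map_mul, map_pow, constantCoeff_C, constantCoeff_X, hX,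
      map_zero] at h
    refine (mul_eq_zero.1 ?_).resolve_right (pow_ne_zero 3 hc)
    linear_combination h
  obtain ⟨z, hz⟩ : (X : F⟦X⟧) ∣ w + 1 := X_dvd_iff.2 (by simpa using hw0)
  exact ⟨u, z, hu, by linear_combination hw + X ^ 2 * hz⟩

open PowerSeries in
theorem constantCoeff_eq_of_root {F : Type*} [Field F] {c d : F} (hd : d ≠ 0) {u : F⟦X⟧}
    (hc : c ≠ 0) (hu : u ^ 4 - C c * u ^ 3 + C c * X ^ 2 * u ^ 2 - C d * X ^ 4 = 0) :
    constantCoeff u = c := by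
  have h := congrArg constantCoeff hu
  simp only [map_sub, map_add, map_mul, map_pow, constantCoeff_C, constantCoeff_X,
    map_zero] at h
  by_contra hne
  have h0 : constantCoeff u = 0 := by
    refine pow_eq_zero_iff (n := 3) (by norm_num) |>.1
      ((mul_eq_zero.1 ?_).resolve_left (sub_ne_zero.2 hne))
    linear_combination h
  obtain ⟨s, rfl⟩ := X_dvd_iff.2 h0
  have hX : (X : F⟦X⟧) ≠ 0 := X_ne_zero
  have hs : X * s ^ 4 - C c * s ^ 3 + C c * X * s ^ 2 - C d * X = 0 := by
    refine mul_left_cancel₀ (pow_ne_zero 3 hX) ?_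
    linear_combination hu
  have hs0 : constantCoeff s = 0 := by
    simpa [hc] using congrArg constantCoeff hs
  obtain ⟨r, rfl⟩ := X_dvd_iff.2 hs0
  have hr : X ^ 4 * r ^ 4 - C c * X ^ 2 * r ^ 3 + C c * X ^ 2 * r ^ 2 - C d = 0 := by
    refine mul_left_cancel₀ hX ?_
    linear_combination hs
  exact hd (by simpa using congrArg constantCoeff hr)

open PowerSeries in
theorem powerSeries_root_unique {F : Type*} [Field F] {c d : F} (hc : c ≠ 0) (hd : d ≠ 0)
    {u v : F⟦X⟧} (hu : u ^ 4 - C c * u ^ 3 + C c * X ^ 2 * u ^ 2 - C d * X ^ 4 = 0)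
    (hv : v ^ 4 - C c * v ^ 3 + C c * X ^ 2 * v ^ 2 - C d * X ^ 4 = 0) : u = v := by
  have hu0 := constantCoeff_eq_of_root hd hc hu
  have hv0 := constantCoeff_eq_of_root hd hc hv
  have h : (u - v) * (u ^ 3 + u ^ 2 * v + u * v ^ 2 + v ^ 3 - C c * (u ^ 2 + u * v + v ^ 2)
      + C c * X ^ 2 * (u + v)) = 0 := by
    linear_combination hu - hv
  refine sub_eq_zero.1 ((mul_eq_zero.1 h).resolve_right fun h0 => pow_ne_zero 3 hc ?_)
  have h1 := congrArg constantCoeff h0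
  simp only [map_sub, map_add, map_mul, map_pow, constantCoeff_C, constantCoeff_X, hu0, hv0,
    map_zero] at h1
  linear_combination h1

open PowerSeries in
/-- Power series are integrally closed in Laurent series, so Laurent roots are power series. -/
theorem exists_powerSeries_eq_of_root {F : Type*} [Field F] (c d : F) {y : LaurentSeries F}
    (hy : y ^ 4 - algebraMap F⟦X⟧ _ (C c) * y ^ 3 + algebraMap F⟦X⟧ _ (C c * X ^ 2) * y ^ 2
      - algebraMap F⟦X⟧ _ (C d * X ^ 4) = 0) :
    ∃ u : F⟦X⟧, algebraMap F⟦X⟧ (LaurentSeries F) u = y := by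
  refine IsIntegrallyClosed.isIntegral_iff.1
    ⟨.X ^ 4 - .C (C c) * .X ^ 3 + .C (C c * X ^ 2) * .X ^ 2 - .C (C d * X ^ 4), ?_, ?_⟩
  · monicity!
  · simpa only [Polynomial.eval₂_sub, Polynomial.eval₂_add, Polynomial.eval₂_mul,
      Polynomial.eval₂_pow, Polynomial.eval₂_X, Polynomial.eval₂_C] using hy

theorem Tvar_mul_algebraMap_X (F : Type*) [Field F] :
    Tvar F * algebraMap (PowerSeries F) (LaurentSeries F) PowerSeries.X = 1 := by
  rw [LaurentSeries.coe_algebraMap, HahnSeries.ofPowerSeries_X, Tvar,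
    HahnSeries.single_mul_single]
  simp

open PowerSeries in
/-- The rescaling `γ = T y` turns the quartic into one with power series coefficients. -/
theorem quartic_eq_zero_iff {F : Type*} [Field F] (h2 : (2 : F) ≠ 0) (h3 : (3 : F) ≠ 0)
    (y : LaurentSeries F) :
    (9 / 32) * (Tvar F * y) ^ 4 - Tvar F * (Tvar F * y) ^ 3 + (Tvar F * y) ^ 2 - 8 / 27 = 0 ↔
    y ^ 4 - algebraMap F⟦X⟧ _ (C (32 / 9)) * y ^ 3
      + algebraMap F⟦X⟧ _ (C (32 / 9) * X ^ 2) * y ^ 2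
      - algebraMap F⟦X⟧ _ (C (256 / 243) * X ^ 4) = 0 := by
  have hK2 : (2 : LaurentSeries F) ≠ 0 := by
    rw [← map_ofNat (HahnSeries.C : F →+* LaurentSeries F) 2]
    exact (map_ne_zero _).2 h2
  have hK3 : (3 : LaurentSeries F) ≠ 0 := by
    rw [← map_ofNat (HahnSeries.C : F →+* LaurentSeries F) 3]
    exact (map_ne_zero _).2 h3
  have hT := Tvar_mul_algebraMap_X F
  have hC (a : F) : algebraMap F⟦X⟧ (LaurentSeries F) (C a) = HahnSeries.C a := by
    simp [LaurentSeries.coe_algebraMap]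
  simp only [map_mul, map_pow, hC, map_div₀, map_ofNat]
  set T := Tvar F
  set t := algebraMap F⟦X⟧ (LaurentSeries F) X
  have hT0 : T ≠ 0 := left_ne_zero_of_mul_eq_one hT
  have ht : t = T⁻¹ := eq_inv_of_mul_eq_one_right hT
  have h9 : (9 : LaurentSeries F) ≠ 0 := by
    rw [show (9 : LaurentSeries F) = 3 ^ 2 by norm_num]; exact pow_ne_zero _ hK3
  have h27 : (27 : LaurentSeries F) ≠ 0 := by
    rw [show (27 : LaurentSeries F) = 3 ^ 3 by norm_num]; exact pow_ne_zero _ hK3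
  have h243 : (243 : LaurentSeries F) ≠ 0 := by
    rw [show (243 : LaurentSeries F) = 3 ^ 5 by norm_num]; exact pow_ne_zero _ hK3
  have h32 : (32 : LaurentSeries F) ≠ 0 := by
    rw [show (32 : LaurentSeries F) = 2 ^ 5 by norm_num]; exact pow_ne_zero _ hK2
  have hk : 9 / 32 * T ^ 4 ≠ 0 := mul_ne_zero (div_ne_zero h9 h32) (pow_ne_zero 4 hT0)
  rw [ht]
  refine Iff.trans (Eq.congr_left ?_) (mul_eq_zero_iff_left hk)
  field_simp
  ring

/-- For `p > 3` prime, `(9/32)X⁴ - TX³ + X² - 8/27` has a unique root `α` in `F_p((1/T))`,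
and `α = (32/9)T - T⁻¹ + (terms of absolute value < |T|⁻¹)` (i.e. the remainder is `0` or
has order `> 1` as a series in `1/T`). -/
theorem RQE_unique_root (p : ℕ) [Fact p.Prime] (hp : 3 < p) :
    ∃ α : LaurentSeries (ZMod p),
      ((9 / 32) * α ^ 4 - Tvar (ZMod p) * α ^ 3 + α ^ 2 - 8 / 27 = 0 ∧
        ∀ γ : LaurentSeries (ZMod p),
          (9 / 32) * γ ^ 4 - Tvar (ZMod p) * γ ^ 3 + γ ^ 2 - 8 / 27 = 0 → γ = α) ∧
      (α - ((32 / 9) * Tvar (ZMod p) - (Tvar (ZMod p))⁻¹) = 0 ∨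
        1 < (α - ((32 / 9) * Tvar (ZMod p) - (Tvar (ZMod p))⁻¹)).order) := by
  have h2 : (2 : ZMod p) ≠ 0 := fun h =>
    absurd (Nat.le_of_dvd two_pos ((ZMod.natCast_eq_zero_iff 2 p).1 (by exact_mod_cast h)))
      (by lia)
  have h3 : (3 : ZMod p) ≠ 0 := fun h =>
    absurd (Nat.le_of_dvd three_pos ((ZMod.natCast_eq_zero_iff 3 p).1 (by exact_mod_cast h)))
      (by lia)
  have hc : (32 / 9 : ZMod p) ≠ 0 := by
    rw [show (32 / 9 : ZMod p) = 2 ^ 5 / 3 ^ 2 by norm_num]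
    exact div_ne_zero (pow_ne_zero _ h2) (pow_ne_zero _ h3)
  have hd : (256 / 243 : ZMod p) ≠ 0 := by
    rw [show (256 / 243 : ZMod p) = 2 ^ 8 / 3 ^ 5 by norm_num]
    exact div_ne_zero (pow_ne_zero _ h2) (pow_ne_zero _ h3)
  have hT := Tvar_mul_algebraMap_X (ZMod p)
  have hT0 : Tvar (ZMod p) ≠ 0 := left_ne_zero_of_mul_eq_one hT
  obtain ⟨u, z, hu, hz⟩ := exists_powerSeries_root hc (256 / 243)
  refine ⟨Tvar (ZMod p) * algebraMap _ _ u, ⟨?_, fun γ hγ => ?_⟩, ?_⟩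
  · rw [quartic_eq_zero_iff h2 h3]
    simpa only [map_sub, map_add, map_mul, map_pow, map_zero] using
      congrArg (algebraMap _ (LaurentSeries (ZMod p))) hu
  · obtain ⟨y, rfl⟩ : ∃ y, γ = Tvar (ZMod p) * y := ⟨_, (mul_inv_cancel_left₀ hT0 γ).symm⟩
    rw [quartic_eq_zero_iff h2 h3] at hγ
    obtain ⟨v, rfl⟩ := exists_powerSeries_eq_of_root _ _ hγ
    rw [powerSeries_root_unique hc hd (u := v) (v := u) ?_ hu]
    refine IsFractionRing.injective _ (LaurentSeries (ZMod p)) ?_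
    simpa only [map_sub, map_add, map_mul, map_pow, map_zero] using hγ
  · have hrem : Tvar (ZMod p) * algebraMap _ _ u - ((32 / 9) * Tvar (ZMod p) - (Tvar (ZMod p))⁻¹)
        = algebraMap _ _ (PowerSeries.X ^ 2 * z) := by
      rw [hz, ← eq_inv_of_mul_eq_one_right hT]
      have hC : algebraMap (PowerSeries (ZMod p)) (LaurentSeries (ZMod p)) (PowerSeries.C (32 / 9))
          = 32 / 9 := by
        rw [LaurentSeries.coe_algebraMap, HahnSeries.ofPowerSeries_C, map_div₀,
          map_ofNat, map_ofNat]
      simp only [map_sub, map_add, map_mul, map_pow, hC]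
      set t := algebraMap (PowerSeries (ZMod p)) (LaurentSeries (ZMod p)) PowerSeries.X
      set w := algebraMap (PowerSeries (ZMod p)) (LaurentSeries (ZMod p)) z
      linear_combination (t ^ 2 * w - t) * hT
    rw [hrem, or_iff_not_imp_left]
    intro hne
    by_contra! hle
    refine HahnSeries.coeff_order_eq_zero.not.2 hne ?_
    rw [LaurentSeries.coe_algebraMap] at hle ⊢
    rw [PowerSeries.coeff_coe]
    split_ifs
    · rfl
    · exact PowerSeries.X_pow_dvd_iff.1 (dvd_mul_right _ z) _ (by lia)
end
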